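/- Private gradient descent with filtering is (α, αB_norm/(2σ²C²))-Rényi differentially private for all α > 1: if at each step t the clipped per-example gradients satisfy Σ_{j=1}^t ‖ḡ_j(X_i)‖₂² ≤ B_norm for every i (enforced by the adaptive clipping rule), and the released quantity at step t is (1/n)Σ_i ḡ_t(X_i) + N(0, σ²C²I) — with gradients clipped to norm at most C — then the full sequence of releases has order-α Rényi divergence at most αB_norm/(2σ²C²) between runs on S and on S^{-i}, for all i. -/

import Mathlib

open MeasureTheory ProbabilityTheory Real

/-- Rényi divergence of order `α`. -/
noncomputable def renyiDiv {Ω : Type*} [MeasurableSpace Ω] (α : ℝ) (μ ν : Measure Ω) : ℝ :=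
  (α - 1)⁻¹ * Real.log (∫ x, ((μ.rnDeriv ν) x).toReal ^ α ∂ν)

/-- Joint law of the outputs of an adaptive composition with per-round conditional
output laws `step t h` given the history `h` of previous released quantities. -/
noncomputable def jointM {Y : Type*} [MeasurableSpace Y]
    (step : (t : ℕ) → (Fin t → Y) → Measure Y) : (k : ℕ) → Measure (Fin k → Y)
  | 0 => Measure.dirac (fun i : Fin 0 => i.elim0)
  | (k + 1) => (jointM step (k : ℕ)).bind fun h => (step k h).map fun a => Fin.snoc h a

/-- The release of noisy gradient descent with filtering at step `t`, run on the points
indexed by `I`: `(1/n) Σ_{i∈I} ḡ_t(X_i) + N(0, σ²C²I_d)`, where `ḡ t h x` is the clipped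
gradient of point `x` at step `t`, a function of the previously released quantities `h`. -/
noncomputable def gdStep {𝒳 : Type*} (d n : ℕ) (X : Fin n → 𝒳)
    (gbar : (t : ℕ) → (Fin t → Fin d → ℝ) → 𝒳 → Fin d → ℝ) (σ C : NNReal)
    (I : Finset (Fin n)) (t : ℕ) (h : Fin t → Fin d → ℝ) : Measure (Fin d → ℝ) :=
  Measure.map (fun ξ => (fun s => (1 / (n : ℝ)) * ∑ i ∈ I, gbar t h (X i) s) + ξ)
    (Measure.pi fun _ : Fin d => gaussianReal 0 ((σ * C) ^ 2))

section AuxProof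
open scoped ENNReal NNReal

lemma aux_lintegral_pi_prod (d : ℕ) (f : Fin d → ℝ → ℝ≥0∞) (hf : ∀ i, Measurable (f i)) :
    ∫⁻ x : Fin d → ℝ, ∏ i, f i (x i) = ∏ i, ∫⁻ y, f i y := by
  induction d with
  | zero => simp [volume_pi]
  | succ d ih =>
    have hp := (volume_preserving_piFinSuccAbove (fun _ : Fin (d + 1) => ℝ) 0).symm
    rw [← hp.lintegral_comp_emb (MeasurableEquiv.measurableEmbedding _)]
    rw [Fin.prod_univ_succ, ← ih (fun i => f i.succ) (fun i => hf _)]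
    rw [← lintegral_prod_mul (hf 0).aemeasurable
      (Finset.measurable_fun_prod _ fun i _ => (hf i.succ).comp (measurable_pi_apply i)).aemeasurable]
    refine lintegral_congr fun z => ?_
    rw [Fin.prod_univ_succ]
    rfl

/-- the step law -/
noncomputable def auxStep (d : ℕ) (v : ℝ≥0) (a : Fin d → ℝ) : Measure (Fin d → ℝ) :=
  Measure.map (fun ξ => a + ξ) (Measure.pi fun _ : Fin d => gaussianReal 0 v)

lemma auxStep_eq (d : ℕ) (v : ℝ≥0) (hv : v ≠ 0) (a : Fin d → ℝ) :
    auxStep d v a = (volume : Measure (Fin d → ℝ)).withDensity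
      (fun y => ∏ s, gaussianPDF (a s) v (y s)) := by
  have h1 : auxStep d v a = Measure.pi fun s => gaussianReal (a s) v := by
    have := Measure.pi_map_pi (μ := fun _ : Fin d => gaussianReal 0 v)
      (f := fun s x => a s + x) (fun s => by fun_prop)
    simp only [gaussianReal_map_const_add, zero_add] at this
    rw [← this]; rfl
  rw [h1]
  refine Measure.pi_eq fun s hs => ?_
  rw [withDensity_apply _ (MeasurableSet.univ_pi hs), ← lintegral_indicator (MeasurableSet.univ_pi hs)]
  have : ∀ x : Fin d → ℝ, (Set.univ.pi s).indicator (fun y => ∏ s, gaussianPDF (a s) v (y s)) x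
      = ∏ i, (s i).indicator (gaussianPDF (a i) v) (x i) := by
    intro x
    by_cases hx : x ∈ Set.univ.pi s
    · rw [Set.indicator_of_mem hx]
      refine Finset.prod_congr rfl fun i _ => ?_
      rw [Set.indicator_of_mem (hx i trivial)]
    · rw [Set.indicator_of_notMem hx]
      simp only [Set.mem_pi, Set.mem_univ, true_imp_iff, not_forall] at hx
      obtain ⟨i, hi⟩ := hx
      exact (Finset.prod_eq_zero (Finset.mem_univ i) (Set.indicator_of_notMem hi _)).symm
  simp_rw [this]
  rw [aux_lintegral_pi_prod d _ (fun i => (measurable_gaussianPDF _ _).indicator (hs i))]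
  refine Finset.prod_congr rfl fun i _ => ?_
  rw [lintegral_indicator (hs i), gaussianReal_of_var_ne_zero _ hv, withDensity_apply _ (hs i)]

instance (d : ℕ) (v : ℝ≥0) (a : Fin d → ℝ) : IsProbabilityMeasure (auxStep d v a) :=
  Measure.isProbabilityMeasure_map (by fun_prop)

lemma aux_meas_gauss {β : Type*} [MeasurableSpace β] (v : ℝ≥0) {μ : Measure β} {f g : β → ℝ}
    (hf : AEMeasurable f μ) (hg : AEMeasurable g μ) :
    AEMeasurable (fun x => gaussianPDF (f x) v (g x)) μ := by
  unfold gaussianPDF gaussianPDFReal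
  fun_prop

/-- density of the joint law -/
noncomputable def auxDens (d : ℕ) (v : ℝ≥0) (m : (t : ℕ) → (Fin t → Fin d → ℝ) → Fin d → ℝ)
    (k : ℕ) (z : Fin k → Fin d → ℝ) : ℝ≥0∞ :=
  ∏ j : Fin k, ∏ s, gaussianPDF (m j.1 (fun u : Fin j.1 => z ⟨u.1, u.2.trans j.2⟩) s) v (z j s)

lemma auxDens_succ (d : ℕ) (v : ℝ≥0) (m : (t : ℕ) → (Fin t → Fin d → ℝ) → Fin d → ℝ)
    (k : ℕ) (z : Fin (k + 1) → Fin d → ℝ) :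
    auxDens d v m (k + 1) z = auxDens d v m k (fun u => z u.castSucc) *
      ∏ s, gaussianPDF (m k (fun u => z u.castSucc) s) v (z (Fin.last k) s) := by
  unfold auxDens
  rw [Fin.prod_univ_castSucc]
  rfl

lemma auxDens_pos (d : ℕ) (v : ℝ≥0) (hv : v ≠ 0)
    (m : (t : ℕ) → (Fin t → Fin d → ℝ) → Fin d → ℝ)
    (k : ℕ) (z : Fin k → Fin d → ℝ) : auxDens d v m k z ≠ 0 := by
  unfold auxDens
  refine Finset.prod_ne_zero_iff.2 fun j _ => Finset.prod_ne_zero_iff.2 fun s _ => ?_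
  exact (gaussianPDF_pos _ hv _).ne'

lemma auxDens_top (d : ℕ) (v : ℝ≥0)
    (m : (t : ℕ) → (Fin t → Fin d → ℝ) → Fin d → ℝ)
    (k : ℕ) (z : Fin k → Fin d → ℝ) : auxDens d v m k z ≠ ∞ := by
  unfold auxDens
  refine ENNReal.prod_ne_top fun j _ => ENNReal.prod_ne_top fun s _ => ?_
  exact ENNReal.ofReal_ne_top

/-- splitting off the last coordinate -/
lemma aux_mp (d k : ℕ) : MeasurePreserving
    (fun p : (Fin d → ℝ) × (Fin k → Fin d → ℝ) =>
      (Fin.snoc (α := fun _ => Fin d → ℝ) p.2 p.1 : Fin (k + 1) → Fin d → ℝ)) := by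
  have hp := (volume_preserving_piFinSuccAbove (fun _ : Fin (k + 1) => Fin d → ℝ) (Fin.last k)).symm
  convert hp using 1
  funext p
  exact (Fin.insertNth_last' (β := Fin d → ℝ) p.1 p.2).symm

lemma aux_qmp (d k : ℕ) : Measure.QuasiMeasurePreserving
    (fun z : Fin (k + 1) → Fin d → ℝ => (fun u : Fin k => z u.castSucc)) := by
  have hp := (volume_preserving_piFinSuccAbove (fun _ : Fin (k + 1) => Fin d → ℝ) (Fin.last k))
  have := Measure.quasiMeasurePreserving_snd.comp hp.quasiMeasurePreserving
  have he : (fun z : Fin (k + 1) → Fin d → ℝ => (fun u : Fin k => z u.castSucc)) =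
      Prod.snd ∘ ⇑(MeasurableEquiv.piFinSuccAbove (fun _ => Fin d → ℝ) (Fin.last k)) := by
    funext z u
    simp [MeasurableEquiv.piFinSuccAbove, Fin.insertNthEquiv, Fin.init]
  rw [he]
  exact this

lemma auxDens_meas (d : ℕ) (v : ℝ≥0)
    (m : (t : ℕ) → (Fin t → Fin d → ℝ) → Fin d → ℝ) (k : ℕ)
    (hm : ∀ t < k, AEMeasurable (m t) volume) : AEMeasurable (auxDens d v m k) volume := by
  induction k with
  | zero => unfold auxDens; simp
  | succ k ih =>
    have : auxDens d v m (k + 1) = fun z => auxDens d v m k (fun u => z u.castSucc) *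
      ∏ s, gaussianPDF (m k (fun u => z u.castSucc) s) v (z (Fin.last k) s) :=
      funext (auxDens_succ d v m k)
    rw [this]
    have h1 := (ih fun t ht => hm t (by omega)).comp_quasiMeasurePreserving (aux_qmp d k)
    have h2 := (hm k (by omega)).comp_quasiMeasurePreserving (aux_qmp d k)
    refine h1.mul (Finset.aemeasurable_fun_prod _ fun s _ => aux_meas_gauss v ?_
      ((measurable_pi_apply s).comp (measurable_pi_apply (Fin.last k))).aemeasurable)
    exact (measurable_pi_apply s).comp_aemeasurable h2

noncomputable def auxKer (d : ℕ) (v : ℝ≥0) (m : (t : ℕ) → (Fin t → Fin d → ℝ) → Fin d → ℝ)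
    (k : ℕ) (h : Fin k → Fin d → ℝ) : Measure (Fin (k + 1) → Fin d → ℝ) :=
  (auxStep d v (m k h)).map fun a => (Fin.snoc (α := fun _ => Fin d → ℝ) h a : Fin (k + 1) → Fin d → ℝ)

noncomputable def auxJ (d : ℕ) (v : ℝ≥0) (m : (t : ℕ) → (Fin t → Fin d → ℝ) → Fin d → ℝ)
    (k : ℕ) : Measure (Fin k → Fin d → ℝ) := jointM (fun t h => auxStep d v (m t h)) k

lemma auxJ_succ (d : ℕ) (v : ℝ≥0) (m : (t : ℕ) → (Fin t → Fin d → ℝ) → Fin d → ℝ)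
    (k : ℕ) : auxJ d v m (k + 1) = (auxJ d v m k).bind (auxKer d v m k) := rfl

lemma aux_snoc_meas (d k : ℕ) : Measurable 
    (fun p : (Fin k → Fin d → ℝ) × (Fin d → ℝ) =>
      (Fin.snoc (α := fun _ => Fin d → ℝ) p.1 p.2 : Fin (k + 1) → Fin d → ℝ)) :=
  (aux_mp d k).measurable.comp measurable_swap

lemma aux_snoc_meas' (d k : ℕ) (h : Fin k → Fin d → ℝ) : Measurable 
    (fun p : (Fin d → ℝ) =>
      (Fin.snoc (α := fun _ => Fin d → ℝ) h p : Fin (k + 1) → Fin d → ℝ)) :=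
  (aux_snoc_meas d k).comp measurable_prodMk_left

instance (d : ℕ) (v : ℝ≥0) (m : (t : ℕ) → (Fin t → Fin d → ℝ) → Fin d → ℝ)
    (k : ℕ) (h : Fin k → Fin d → ℝ) : IsProbabilityMeasure (auxKer d v m k h) :=
  Measure.isProbabilityMeasure_map (aux_snoc_meas' d k h).aemeasurable

lemma auxJ_le (d : ℕ) (v : ℝ≥0) (m : (t : ℕ) → (Fin t → Fin d → ℝ) → Fin d → ℝ)
    (k : ℕ) : auxJ d v m k Set.univ ≤ 1 := by
  induction k with
  | zero => simp [auxJ, jointM]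
  | succ k ih =>
    rw [auxJ_succ]
    refine (Measure.bind_apply_le _ MeasurableSet.univ).trans ?_
    simpa using ih

lemma auxKer_meas (d : ℕ) (v : ℝ≥0) (m : (t : ℕ) → (Fin t → Fin d → ℝ) → Fin d → ℝ)
    (k : ℕ) (μ : Measure (Fin k → Fin d → ℝ)) (hm : AEMeasurable (m k) μ) :
    AEMeasurable (auxKer d v m k) μ := by
  refine ⟨fun h => (Measure.pi fun _ : Fin d => gaussianReal 0 v).map
    fun ξ => (Fin.snoc (α := fun _ => Fin d → ℝ) h (hm.mk _ h + ξ) : Fin (k + 1) → Fin d → ℝ),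
    ?_, ?_⟩
  · have hF : Measurable fun p : (Fin k → Fin d → ℝ) × (Fin d → ℝ) =>
        (Fin.snoc (α := fun _ => Fin d → ℝ) p.1 (hm.mk _ p.1 + p.2) : Fin (k + 1) → Fin d → ℝ) := by
      have h2 : Measurable fun p : (Fin k → Fin d → ℝ) × (Fin d → ℝ) => 
          (p.1, hm.mk _ p.1 + p.2) := 
        measurable_fst.prodMk ((hm.measurable_mk.comp measurable_fst).add measurable_snd)
      exact (aux_snoc_meas d k).comp h2
    refine Measure.measurable_of_measurable_coe _ fun s hs => ?_
    have : ∀ h, (Measure.pi fun _ : Fin d => gaussianReal 0 v).map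
      (fun ξ => (Fin.snoc (α := fun _ => Fin d → ℝ) h (hm.mk _ h + ξ) : Fin (k + 1) → Fin d → ℝ)) s
      = (Measure.pi fun _ : Fin d => gaussianReal 0 v) (Prod.mk h ⁻¹' ((fun p : (Fin k → Fin d → ℝ) × (Fin d → ℝ) =>
        (Fin.snoc (α := fun _ => Fin d → ℝ) p.1 (hm.mk _ p.1 + p.2) : Fin (k + 1) → Fin d → ℝ)) ⁻¹' s)) := by
      intro h
      exact Measure.map_apply (hF.comp measurable_prodMk_left) hs
    simp_rw [this]
    exact measurable_measure_prodMk_left (hF hs)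
  · filter_upwards [hm.ae_eq_mk] with h hh
    unfold auxKer auxStep
    rw [Measure.map_map (aux_snoc_meas' d k h) (by fun_prop), ← hh]
    rfl

lemma auxJ_eq (d : ℕ) (v : ℝ≥0) (hv : v ≠ 0)
    (m : (t : ℕ) → (Fin t → Fin d → ℝ) → Fin d → ℝ) (k : ℕ)
    (hm : ∀ t < k, AEMeasurable (m t) volume) :
    auxJ d v m k = volume.withDensity (auxDens d v m k) := by
  induction k with
  | zero =>
    have : auxDens d v m 0 = 1 := by funext z; simp [auxDens]
    rw [this, withDensity_one]
    simp only [auxJ, jointM]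
    rw [volume_pi, Measure.pi_of_empty]
    congr 1
  | succ k ih =>
    have hm' : ∀ t < k, AEMeasurable (m t) volume := fun t ht => hm t (by omega)
    have hfm := auxDens_meas d v m (k + 1) hm
    rw [auxJ_succ, ih hm']
    ext s hs
    rw [Measure.bind_apply hs (auxKer_meas d v m k _ 
      ((hm k (by omega)).mono_ac (withDensity_absolutelyContinuous _ _)))]
    rw [withDensity_apply _ hs, ← lintegral_indicator hs]
    rw [← (aux_mp d k).map_eq, lintegral_map' (by rw [(aux_mp d k).map_eq]; exact hfm.indicator hs)
      (aux_mp d k).measurable.aemeasurable]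
    rw [Measure.volume_eq_prod, lintegral_prod_symm _ ?_]
    swap
    · exact ((hfm.indicator hs).comp_quasiMeasurePreserving (aux_mp d k).quasiMeasurePreserving)
    rw [lintegral_withDensity_eq_lintegral_mul_non_measurable₀ _ (auxDens_meas d v m k hm')
      (Filter.Eventually.of_forall fun z => (auxDens_top d v m k z).lt_top)]
    refine lintegral_congr fun h => ?_
    simp only [Pi.mul_apply]
    unfold auxKer
    have hs' := aux_snoc_meas' d k h hs
    rw [Measure.map_apply (aux_snoc_meas' d k h) hs, auxStep_eq d v hv, withDensity_apply _ hs',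
      ← lintegral_indicator hs', ← lintegral_const_mul' _ _ (auxDens_top d v m k h)]
    refine lintegral_congr fun y => ?_
    by_cases hy : (Fin.snoc (α := fun _ => Fin d → ℝ) h y : Fin (k + 1) → Fin d → ℝ) ∈ s
    · rw [Set.indicator_of_mem hy, Set.indicator_of_mem (by exact hy), auxDens_succ]
      simp
    · rw [Set.indicator_of_notMem hy, Set.indicator_of_notMem (by exact hy), mul_zero]

lemma aux_mean_meas (d : ℕ) (v : ℝ≥0) (m : (t : ℕ) → (Fin t → Fin d → ℝ) → Fin d → ℝ)
    (k : ℕ) (μ : Measure (Fin k → Fin d → ℝ)) 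
    (hm : AEMeasurable (auxKer d v m k) μ) : AEMeasurable (m k) μ := by
  refine aemeasurable_pi_iff.2 fun s => ?_
  set K := ∫⁻ x, ENNReal.ofReal (rexp x) ∂(gaussianReal 0 v) with hK
  have hK0 : K ≠ 0 := by
    intro h0
    rw [hK, lintegral_eq_zero_iff (by fun_prop)] at h0
    obtain ⟨x, hx⟩ := h0.exists
    simp only [Pi.zero_apply, ENNReal.ofReal_eq_zero] at hx
    exact absurd (Real.exp_pos x) (not_lt.2 hx)
  have hKt : K ≠ ∞ := by
    have := (integrable_exp_mul_gaussianReal (μ := 0) (v := v) 1).lintegral_lt_top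
    simpa [hK] using this.ne
  have hI : ∀ h, ∫⁻ z, ENNReal.ofReal (rexp (z (Fin.last k) s)) ∂(auxKer d v m k h)
      = ENNReal.ofReal (rexp (m k h s)) * K := by
    intro h
    unfold auxKer auxStep
    rw [lintegral_map (by fun_prop) (aux_snoc_meas' d k h), lintegral_map (by simp; fun_prop) (by fun_prop)]
    simp only [Fin.snoc_last, Pi.add_apply, Real.exp_add, ENNReal.ofReal_mul (Real.exp_pos _).le]
    rw [lintegral_const_mul _ (by fun_prop)]
    congr 1
    exact (measurePreserving_eval (fun _ : Fin d => gaussianReal 0 v) s).lintegral_comp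
      (f := fun x => ENNReal.ofReal (rexp x)) (by fun_prop)
  have hform : (fun h => m k h s) = fun h => Real.log 
      ((∫⁻ z, ENNReal.ofReal (rexp (z (Fin.last k) s)) ∂(auxKer d v m k h)) / K).toReal := by
    funext h
    rw [hI, ENNReal.mul_div_cancel_right hK0 hKt, ENNReal.toReal_ofReal (Real.exp_pos _).le, Real.log_exp]
  rw [hform]
  have := (Measure.measurable_lintegral (f := fun z : Fin (k+1) → Fin d → ℝ => 
    ENNReal.ofReal (rexp (z (Fin.last k) s))) (by fun_prop)).comp_aemeasurable hm
  simp only [Function.comp_def] at this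
  fun_prop

lemma aux_meas_of_ne (d : ℕ) (v : ℝ≥0) (hv : v ≠ 0)
    (m : (t : ℕ) → (Fin t → Fin d → ℝ) → Fin d → ℝ) (k : ℕ)
    (hJ : auxJ d v m k ≠ 0) : ∀ t < k, AEMeasurable (m t) volume := by
  induction k with
  | zero => intro t ht; omega
  | succ k ih =>
    rw [auxJ_succ] at hJ
    have h0 : auxJ d v m k ≠ 0 := by
      intro h; rw [h] at hJ; simp at hJ
    have hk : AEMeasurable (auxKer d v m k) (auxJ d v m k) := by
      by_contra hc
      rw [Measure.bind, Measure.map_of_not_aemeasurable hc] at hJ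
      simp at hJ
    have ih := ih h0
    intro t ht
    rcases Nat.lt_succ_iff_lt_or_eq.1 ht with h | rfl
    · exact ih t h
    · have := aux_mean_meas d v m t _ hk
      rw [auxJ_eq d v hv m t ih] at this
      exact this.mono_ac (withDensity_absolutelyContinuous' (auxDens_meas d v m t ih)
        (Filter.Eventually.of_forall (auxDens_pos d v hv m t)))

lemma aux_pdf (v : ℝ≥0) (hv : v ≠ 0) (α a b y : ℝ) :
    ((gaussianPDFReal b v y)⁻¹ * gaussianPDFReal a v y) ^ α * gaussianPDFReal b v y
      = gaussianPDFReal (b + α * (a - b)) v y * rexp (α * (α - 1) / (2 * v) * (a - b) ^ 2) := by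
  have hv' : (0 : ℝ) < v := by positivity
  have hc : (√(2 * π * v))⁻¹ ≠ 0 := by positivity
  have h1 : (gaussianPDFReal b v y)⁻¹ * gaussianPDFReal a v y
      = rexp (-(y - a) ^ 2 / (2 * v) - -(y - b) ^ 2 / (2 * v)) := by
    rw [Real.exp_sub]
    unfold gaussianPDFReal
    field_simp
  rw [h1, ← Real.exp_mul]
  unfold gaussianPDFReal
  rw [mul_left_comm, mul_assoc _ (rexp _) (rexp _), ← Real.exp_add, ← Real.exp_add]
  congr 2
  field_simp
  ring

lemma aux_dens_id (d : ℕ) (v : ℝ≥0) (hv : v ≠ 0) (α : ℝ)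
    (a b : (t : ℕ) → (Fin t → Fin d → ℝ) → Fin d → ℝ) (k : ℕ) (z : Fin k → Fin d → ℝ) :
    ((auxDens d v b k z)⁻¹ * auxDens d v a k z).toReal ^ α * (auxDens d v b k z).toReal
     = (auxDens d v (fun t h s => b t h s + α * (a t h s - b t h s)) k z).toReal *
      rexp (α * (α - 1) / (2 * v) * ∑ j : Fin k, ∑ s, 
        (a j.1 (fun u : Fin j.1 => z ⟨u.1, u.2.trans j.2⟩) s
          - b j.1 (fun u : Fin j.1 => z ⟨u.1, u.2.trans j.2⟩) s) ^ 2) := by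
  unfold auxDens
  simp only [ENNReal.toReal_mul, ENNReal.toReal_inv, ENNReal.toReal_prod, toReal_gaussianPDF]
  simp only [← Finset.prod_inv_distrib, ← Finset.prod_mul_distrib, Finset.mul_sum, Real.exp_sum]
  rw [← Real.finsetProd_rpow _ _ (fun j _ => Finset.prod_nonneg fun s _ => 
    mul_nonneg (inv_nonneg.2 (gaussianPDFReal_nonneg _ _ _)) (gaussianPDFReal_nonneg _ _ _)), 
    ← Finset.prod_mul_distrib]
  refine Finset.prod_congr rfl fun j _ => ?_
  rw [← Real.finsetProd_rpow _ _ (fun s _ =>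
    mul_nonneg (inv_nonneg.2 (gaussianPDFReal_nonneg _ _ _)) (gaussianPDFReal_nonneg _ _ _)), 
    ← Finset.prod_mul_distrib]
  exact Finset.prod_congr rfl fun s _ => aux_pdf v hv α _ _ _

lemma aux_main (d : ℕ) (v : ℝ≥0) (hv : v ≠ 0) (α : ℝ) (hα : 1 < α) (B : ℝ) (hB : 0 < B)
    (a b : (t : ℕ) → (Fin t → Fin d → ℝ) → Fin d → ℝ) (k : ℕ) 
    (hab : ∀ z : Fin k → Fin d → ℝ, ∑ j : Fin k, ∑ s, 
        (a j.1 (fun u : Fin j.1 => z ⟨u.1, u.2.trans j.2⟩) s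
          - b j.1 (fun u : Fin j.1 => z ⟨u.1, u.2.trans j.2⟩) s) ^ 2 ≤ B) :
    renyiDiv α (auxJ d v a k) (auxJ d v b k) ≤ α * B / (2 * v) := by
  have hα0 : α ≠ 0 := by positivity
  have hv' : (0 : ℝ) < v := by positivity
  have hR : 0 ≤ α * B / (2 * v) := by positivity
  by_cases hb0 : auxJ d v b k = 0
  · simpa [renyiDiv, hb0] using hR
  by_cases ha0 : auxJ d v a k = 0
  · have : ∫ x, ((Measure.rnDeriv (0 : Measure (Fin k → Fin d → ℝ)) (auxJ d v b k)) x).toReal ^ α 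
        ∂(auxJ d v b k) = 0 := by
      rw [integral_eq_zero_of_ae]
      filter_upwards [Measure.rnDeriv_zero (auxJ d v b k)] with x hx
      simp [hx, hα0]
    simpa [renyiDiv, ha0, this] using hR
  have ham := aux_meas_of_ne d v hv a k ha0
  have hbm := aux_meas_of_ne d v hv b k hb0
  have hDa := auxDens_meas d v a k ham
  have hDb := auxDens_meas d v b k hbm
  have hcm : ∀ t < k, AEMeasurable ((fun t h s => b t h s + α * (a t h s - b t h s) : 
      (t : ℕ) → (Fin t → Fin d → ℝ) → Fin d → ℝ) t) volume := by
    intro t ht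
    have h1 := aemeasurable_pi_iff.1 (ham t ht)
    have h2 := aemeasurable_pi_iff.1 (hbm t ht)
    refine aemeasurable_pi_iff.2 fun s => ?_
    exact (h2 s).add (((h1 s).sub (h2 s)).const_mul α)
  have hDc := auxDens_meas d v _ k hcm
  have hJc := auxJ_eq d v hv _ k hcm
  have hle := auxJ_le d v (fun t h s => b t h s + α * (a t h s - b t h s)) k
  rw [hJc, withDensity_apply _ MeasurableSet.univ, Measure.restrict_univ] at hle
  rw [auxJ_eq d v hv a k ham, auxJ_eq d v hv b k hbm]
  have hrn : (volume.withDensity (auxDens d v a k)).rnDeriv (volume.withDensity (auxDens d v b k))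
      =ᵐ[volume] fun z => (auxDens d v b k z)⁻¹ * auxDens d v a k z := by
    have : SigmaFinite (volume.withDensity (auxDens d v a k)) := 
      SigmaFinite.withDensity_of_ne_top (Filter.Eventually.of_forall (auxDens_top d v a k))
    filter_upwards [Measure.rnDeriv_withDensity_right (volume.withDensity (auxDens d v a k)) volume
      hDb (Filter.Eventually.of_forall (auxDens_pos d v hv b k))
      (Filter.Eventually.of_forall (auxDens_top d v b k)), 
      Measure.rnDeriv_withDensity₀ volume hDa] with z h1 h2
    rw [h1, h2]
  set E := rexp (α * (α - 1) / (2 * v) * B) with hE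
  have hbound : ∫ x, ((volume.withDensity (auxDens d v a k)).rnDeriv 
      (volume.withDensity (auxDens d v b k)) x).toReal ^ α ∂(volume.withDensity (auxDens d v b k))
      ≤ E := by
    rw [integral_withDensity_eq_integral_toReal_smul₀ hDb 
      (Filter.Eventually.of_forall fun z => (auxDens_top d v b k z).lt_top)]
    have hint : Integrable (fun z => 
        (auxDens d v (fun t h s => b t h s + α * (a t h s - b t h s)) k z).toReal) volume :=
      integrable_toReal_of_lintegral_ne_top hDc (hle.trans_lt ENNReal.one_lt_top).ne
    calc _ ≤ ∫ z, (auxDens d v (fun t h s => b t h s + α * (a t h s - b t h s)) k z).toReal * E := by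
          refine integral_mono_of_nonneg ?_ (hint.mul_const E) ?_
          · exact Filter.Eventually.of_forall fun z => by simp only [smul_eq_mul, Pi.zero_apply]; positivity
          · filter_upwards [hrn] with z hz
            rw [hz, smul_eq_mul, mul_comm, aux_dens_id d v hv]
            refine mul_le_mul_of_nonneg_left (Real.exp_le_exp.2 ?_) ENNReal.toReal_nonneg
            refine mul_le_mul_of_nonneg_left (hab z) ?_
            have : 0 < α - 1 := by linarith
            positivity
      _ = (∫ z, (auxDens d v (fun t h s => b t h s + α * (a t h s - b t h s)) k z).toReal) * E :=
          integral_mul_const _ _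
      _ ≤ 1 * E := by
          refine mul_le_mul_of_nonneg_right ?_ (Real.exp_pos _).le
          rw [integral_toReal hDc (Filter.Eventually.of_forall fun z => (auxDens_top d v _ k z).lt_top)]
          exact ENNReal.toReal_le_of_le_ofReal zero_le_one (by simpa using hle)
      _ = E := one_mul _
  unfold renyiDiv
  set I := ∫ x, ((volume.withDensity (auxDens d v a k)).rnDeriv 
      (volume.withDensity (auxDens d v b k)) x).toReal ^ α ∂(volume.withDensity (auxDens d v b k))
  have hI0 : 0 ≤ I := integral_nonneg fun z => by positivity
  have hα1 : 0 < α - 1 := by linarith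
  rcases hI0.eq_or_lt with h | h
  · rw [← h]; simpa using hR
  · have h3 : Real.log I ≤ α * (α - 1) / (2 * v) * B := by
      rw [← Real.log_exp (α * (α - 1) / (2 * v) * B)]
      exact Real.log_le_log h hbound
    calc _ ≤ (α - 1)⁻¹ * (α * (α - 1) / (2 * v) * B) := 
          mul_le_mul_of_nonneg_left h3 (inv_nonneg.2 hα1.le)
      _ = _ := by field_simp


end AuxProof

/-- Privacy of private gradient descent with filtering (Proposition 6.2): if the clipping
rule enforces that the cumulative squared norms of each point's clipped gradients never
exceed `B_norm` (for every point and every realization of the released iterates), then the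
full sequence of `k` noisy releases is `(α, αB_norm/(2σ²C²))`-Rényi differentially private:
for every `i`, both directions of the order-`α` Rényi divergence between the runs on `S`
and on `S^{-i}` are at most `αB_norm/(2σ²C²)`. -/
theorem private_gd_with_filtering_rdp {𝒳 : Type*} (d n : ℕ) (X : Fin n → 𝒳)
    (gbar : (t : ℕ) → (Fin t → Fin d → ℝ) → 𝒳 → Fin d → ℝ) (σ C : NNReal)
    (hσ : 0 < σ) (hC : 0 < C) (Bnorm : ℝ) (hBnorm : 0 < Bnorm)
    (α : ℝ) (hα : 1 < α) (k : ℕ)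
    (hclip : ∀ (i : Fin n) (h : Fin k → Fin d → ℝ),
      ∑ j : Fin k, ∑ s, (gbar j.1 (fun u : Fin j.1 => h ⟨u.1, u.2.trans j.2⟩) (X i) s) ^ 2
        ≤ Bnorm) :
    ∀ i : Fin n,
      renyiDiv α (jointM (gdStep d n X gbar σ C Finset.univ) k)
          (jointM (gdStep d n X gbar σ C (Finset.univ.erase i)) k)
        ≤ α * Bnorm / (2 * (σ : ℝ) ^ 2 * (C : ℝ) ^ 2) ∧
      renyiDiv α (jointM (gdStep d n X gbar σ C (Finset.univ.erase i)) k)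
          (jointM (gdStep d n X gbar σ C Finset.univ) k)
        ≤ α * Bnorm / (2 * (σ : ℝ) ^ 2 * (C : ℝ) ^ 2) := by
  intro i
  have hv : (σ * C) ^ 2 ≠ 0 := by positivity
  have hn : (1 : ℝ) ≤ n := by
    have := i.pos
    exact_mod_cast this
  have hvv : 2 * (σ : ℝ) ^ 2 * (C : ℝ) ^ 2 = 2 * (((σ * C) ^ 2 : NNReal) : ℝ) := by
    push_cast; ring
  have hn2 : (1 / (n : ℝ)) ^ 2 ≤ 1 := by
    rw [div_pow, one_pow]
    exact div_le_one_of_le₀ (one_le_pow₀ hn) (by positivity)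
  have hdiff : ∀ (t : ℕ) (h : Fin t → Fin d → ℝ) (s : Fin d),
      (1 / (n : ℝ)) * ∑ i, gbar t h (X i) s
      - (1 / (n : ℝ)) * ∑ i ∈ Finset.univ.erase i, gbar t h (X i) s
      = (1 / (n : ℝ)) * gbar t h (X i) s := by
    intro t h s
    rw [← Finset.add_sum_erase Finset.univ _ (Finset.mem_univ i)]
    ring
  have hB : ∀ z : Fin k → Fin d → ℝ, ∑ j : Fin k, ∑ s,
      ((1 / (n : ℝ)) * gbar j.1 (fun u : Fin j.1 => z ⟨u.1, u.2.trans j.2⟩) (X i) s) ^ 2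
        ≤ Bnorm := by
    intro z
    refine le_trans ?_ (hclip i z)
    refine Finset.sum_le_sum fun j _ => Finset.sum_le_sum fun s _ => ?_
    rw [mul_pow]
    exact mul_le_of_le_one_left (sq_nonneg _) hn2
  rw [hvv]
  constructor
  · refine aux_main d _ hv α hα Bnorm hBnorm
      (fun t h s => (1 / (n : ℝ)) * ∑ i, gbar t h (X i) s)
      (fun t h s => (1 / (n : ℝ)) * ∑ i ∈ Finset.univ.erase i, gbar t h (X i) s) k ?_
    intro z
    simp only [hdiff]
    exact hB z
  · refine aux_main d _ hv α hα Bnorm hBnorm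
      (fun t h s => (1 / (n : ℝ)) * ∑ i ∈ Finset.univ.erase i, gbar t h (X i) s)
      (fun t h s => (1 / (n : ℝ)) * ∑ i, gbar t h (X i) s) k ?_
    intro z
    simp only [sub_sq_comm _ ((1 / (n : ℝ)) * ∑ i, gbar _ _ (X i) _), hdiff]
    exact hB z
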